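/- The perspective of the p-th power is jointly convex: for p ≥ 1, the function g(y, x) = y^p / x^{p−1} (equivalently (y/x)^p · x) is convex on the set {(y, x) ∈ ℝ² : y ≥ 0, x > 0}. (This shows the refined UMSC objective term (∑_j p_{ij} y_{ij} / x_i)^p x_i is convex in (y, x_i).) -/

import Mathlib

theorem persp_eq (p y x : ℝ) (hy : 0 ≤ y) (hx : 0 < x) :
    y ^ p / x ^ (p - 1) = x * (y / x) ^ p := by
  have h := Real.rpow_pos_of_pos hx p
  rw [Real.div_rpow hy hx.le, Real.rpow_sub hx, Real.rpow_one]
  field_simp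

theorem perspective_rpow_convex (p : ℝ) (hp : 1 ≤ p) :
    ConvexOn ℝ {q : ℝ × ℝ | 0 ≤ q.1 ∧ 0 < q.2}
      (fun q : ℝ × ℝ => q.1 ^ p / q.2 ^ (p - 1)) := by
  have hc : Convex ℝ {q : ℝ × ℝ | 0 ≤ q.1 ∧ 0 < q.2} := 
    (convex_Ici (0 : ℝ)).prod (convex_Ioi (0 : ℝ))
  refine ⟨hc, ?_⟩
  rintro ⟨y₁, x₁⟩ h₁ ⟨y₂, x₂⟩ h₂ a b ha hb hab
  have h₃ := hc h₁ h₂ ha hb hab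
  simp only [Set.mem_ofPred_eq, Prod.smul_mk, Prod.mk_add_mk, smul_eq_mul] at h₁ h₂ h₃ ⊢
  obtain ⟨hy₁, hx₁⟩ := h₁
  obtain ⟨hy₂, hx₂⟩ := h₂
  obtain ⟨hy, hx⟩ := h₃
  rw [persp_eq p _ _ hy₁ hx₁, persp_eq p _ _ hy₂ hx₂, persp_eq p _ _ hy hx]
  have hu : y₁ / x₁ ∈ Set.Ici (0 : ℝ) := Set.mem_Ici.2 (by positivity)
  have hv : y₂ / x₂ ∈ Set.Ici (0 : ℝ) := Set.mem_Ici.2 (by positivity)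
  have hA : 0 ≤ a * x₁ / (a * x₁ + b * x₂) := by positivity
  have hB : 0 ≤ b * x₂ / (a * x₁ + b * x₂) := by positivity
  have hAB : a * x₁ / (a * x₁ + b * x₂) + b * x₂ / (a * x₁ + b * x₂) = 1 := by
    rw [← add_div, div_self hx.ne']
  have key := (convexOn_rpow hp).2 hu hv hA hB hAB
  simp only [smul_eq_mul] at key
  have e : a * x₁ / (a * x₁ + b * x₂) * (y₁ / x₁) + b * x₂ / (a * x₁ + b * x₂) * (y₂ / x₂)
      = (a * y₁ + b * y₂) / (a * x₁ + b * x₂) := by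
    have := hx.ne'
    field_simp
  rw [e] at key
  refine (mul_le_mul_of_nonneg_left key hx.le).trans (le_of_eq ?_)
  have := hx.ne'
  generalize (y₁ / x₁) ^ p = u
  generalize (y₂ / x₂) ^ p = v
  field_simp
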